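/- Let $\mu$ be a Borel probability measure on $\mathbb{R}^2$, let $\varphi : \mathbb{R}^2 \to \mathbb{R}$ be a smooth compactly supported function with $\varphi \geq 0$, $\int \varphi = 1$, and $\varphi(z) \geq 1$ whenever $|z| \leq 1/2$, and for $k \in \mathbb{N}$ set $\varphi_{2^{-k}}(z) = 2^{2k}\varphi(2^k z)$ and let $\mu^{2^{-k}}$ denote the function $\mu^{2^{-k}}(z) = \int \varphi_{2^{-k}}(z - y)\, d\mu(y)$. Then for every $x \in \mathbb{R}^2$ and every Borel set $D \subset \mathbb{R}$, letting $\widetilde{D} = \{t \in \mathbb{R} : \exists s \in D,\ |t - s| < 2^{-k}\}$ be the open $2^{-k}$-neighborhood of $D$, one has $\mu(\{y : |y - x| \in D\}) \leq \frac{4}{\pi} \int_{\{z : |x - z| \in \widetilde{D}\}} \mu^{2^{-k}}(z)\, dz$. -/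

import Mathlib

open MeasureTheory Set

/-- A convolution kernel `G (z - y)` is integrable in both variables when `G` is continuous with
compact support and `y` is distributed according to a finite measure. -/
theorem integrable_sub_prod_of_hasCompactSupport {E : Type*} [NormedAddCommGroup E]
    [NormedSpace ℝ E] [FiniteDimensional ℝ E] [MeasurableSpace E] [BorelSpace E]
    (ν : Measure E) [SigmaFinite ν] [IsFiniteMeasureOnCompacts ν] [ν.IsAddRightInvariant]
    (μ : Measure E) [IsFiniteMeasure μ]
    {G : E → ℝ} (hG : Continuous G) (hGc : HasCompactSupport G) :
    Integrable (fun p : E × E => G (p.1 - p.2)) (ν.prod μ) := by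
  have hcont : Continuous fun p : E × E => G (p.1 - p.2) := by fun_prop
  refine (integrable_prod_iff' hcont.aestronglyMeasurable).2 ⟨ae_of_all _ fun y => ?_, ?_⟩
  · exact (hG.integrable_of_hasCompactSupport hGc).comp_sub_right y
  · have h : (fun y : E => ∫ z, ‖G (z - y)‖ ∂ν) = fun _ => ∫ z, ‖G z‖ ∂ν :=
      funext fun y => integral_sub_right_eq_self (fun z => ‖G z‖) y
    simpa only [h] using integrable_const _

/-- If `G` is at least `m` on the ball of radius `r`, then its convolution with `μ` gives a set `S`
at least `m` times the area of that ball times the `μ`-mass of any set whose `r`-neighborhood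
lies in `S`. -/
theorem measureReal_mul_le_setIntegral_convolution
    (μ : Measure (EuclideanSpace ℝ (Fin 2))) [IsFiniteMeasure μ]
    {G : EuclideanSpace ℝ (Fin 2) → ℝ} (hG : Continuous G) (hGc : HasCompactSupport G)
    (hG0 : ∀ z, 0 ≤ G z) {r m : ℝ} (hr : 0 ≤ r) (hGm : ∀ z, ‖z‖ < r → m ≤ G z)
    {A S : Set (EuclideanSpace ℝ (Fin 2))} (hA : MeasurableSet A)
    (hAS : ∀ y ∈ A, Metric.ball y r ⊆ S) :
    μ.real A * (Real.pi * r ^ 2 * m) ≤ ∫ z in S, ∫ y, G (z - y) ∂μ := by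
  have hint : Integrable (fun p : EuclideanSpace ℝ (Fin 2) × EuclideanSpace ℝ (Fin 2) =>
      G (p.1 - p.2)) ((volume.restrict S).prod μ) := by
    have h := (integrable_sub_prod_of_hasCompactSupport volume μ hG hGc).restrict
      (s := S ×ˢ univ)
    rwa [← Measure.prod_restrict, Measure.restrict_univ] at h
  have hslice (y : EuclideanSpace ℝ (Fin 2)) : Integrable (fun z => G (z - y)) :=
    (hG.integrable_of_hasCompactSupport hGc).comp_sub_right y
  have hball (y : EuclideanSpace ℝ (Fin 2)) :
      volume.real (Metric.ball y r) = Real.pi * r ^ 2 := by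
    rw [measureReal_def, EuclideanSpace.volume_ball_fin_two]
    simp [ENNReal.toReal_ofReal hr, Real.pi_nonneg, mul_comm]
  calc μ.real A * (Real.pi * r ^ 2 * m)
      = ∫ _ in A, Real.pi * r ^ 2 * m ∂μ := by simp
    _ ≤ ∫ y in A, (∫ z in S, G (z - y)) ∂μ := by
        refine setIntegral_mono_on (integrable_const _) hint.integral_prod_right.integrableOn hA
          fun y hy => ?_
        calc Real.pi * r ^ 2 * m = ∫ _ in Metric.ball y r, m := by
              rw [setIntegral_const, hball, smul_eq_mul]
          _ ≤ ∫ z in Metric.ball y r, G (z - y) := by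
              refine setIntegral_mono_on ?_ (hslice y).integrableOn measurableSet_ball
                fun z hz => hGm _ (mem_ball_iff_norm.1 hz)
              exact integrableOn_const Metric.isBounded_ball.measure_lt_top.ne
          _ ≤ ∫ z in S, G (z - y) :=
              setIntegral_mono_set (hslice y).integrableOn (ae_of_all _ fun z => hG0 _)
                (ae_of_all _ (hAS y hy))
    _ ≤ ∫ y, (∫ z in S, G (z - y)) ∂μ :=
        setIntegral_le_integral hint.integral_prod_right
          (ae_of_all _ fun y => integral_nonneg fun z => hG0 _)
    _ = ∫ z in S, ∫ y, G (z - y) ∂μ := (integral_integral_swap hint).symm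

/-- **Liu, Claim in Section 4 (mollification lower bound).**
Let `μ` be a Borel probability measure on `ℝ²`, `φ` a smooth compactly supported bump with
`φ ≥ 0`, `∫ φ = 1` and `φ ≥ 1` on the ball of radius `1/2`, and let
`μ^{2^{-k}}(z) = ∫ 2^{2k} φ(2^k (z - y)) dμ(y)` be the mollified density.  Then for every
`x ∈ ℝ²` and every Borel set `D ⊆ ℝ`, with `D̃` the open `2^{-k}`-neighborhood of `D`,
`μ {y : |y - x| ∈ D} ≤ (4/π) ∫_{ {z : |x - z| ∈ D̃} } μ^{2^{-k}}(z) dz`. -/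
theorem measure_pinned_le_mollified_integral
    (μ : Measure (EuclideanSpace ℝ (Fin 2))) [IsProbabilityMeasure μ]
    (φ : EuclideanSpace ℝ (Fin 2) → ℝ) (hφsmooth : ContDiff ℝ (⊤ : ℕ∞) φ)
    (hφcompact : HasCompactSupport φ) (hφnonneg : ∀ z, 0 ≤ φ z)
    (hφint : ∫ z, φ z = 1) (hφone : ∀ z : EuclideanSpace ℝ (Fin 2), ‖z‖ ≤ 1 / 2 → 1 ≤ φ z)
    (k : ℕ) (x : EuclideanSpace ℝ (Fin 2)) (D : Set ℝ) (hD : MeasurableSet D) :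
    μ {y | dist y x ∈ D} ≤
      ENNReal.ofReal ((4 / Real.pi) *
        ∫ z in {z : EuclideanSpace ℝ (Fin 2) |
            dist x z ∈ {t : ℝ | ∃ s ∈ D, |t - s| < 2 ^ (-(k : ℝ))}},
          ∫ y, (2 : ℝ) ^ (2 * k) * φ ((2 : ℝ) ^ k • (z - y)) ∂μ) := by
  have hc : (0 : ℝ) < 2 ^ k := by positivity
  have hG : Continuous fun w => (2 : ℝ) ^ (2 * k) * φ ((2 : ℝ) ^ k • w) := by
    have := hφsmooth.continuous
    fun_prop
  have hGc : HasCompactSupport fun w => (2 : ℝ) ^ (2 * k) * φ ((2 : ℝ) ^ k • w) :=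
    (hφcompact.comp_smul hc.ne').mul_left
  have hA : MeasurableSet {y | dist y x ∈ D} := (measurable_id.dist measurable_const) hD
  have key := measureReal_mul_le_setIntegral_convolution μ hG hGc
    (fun w => mul_nonneg (by positivity) (hφnonneg _)) (r := (2 * 2 ^ k)⁻¹) (m := 2 ^ (2 * k))
    (by positivity) (fun w hw => ?_) hA
    (S := {z | dist x z ∈ {t : ℝ | ∃ s ∈ D, |t - s| < 2 ^ (-(k : ℝ))}}) (fun y hy z hz => ?_)
  · rw [← ofReal_measureReal]
    refine ENNReal.ofReal_le_ofReal ?_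
    refine le_trans (le_of_eq ?_) (mul_le_mul_of_nonneg_left key (by positivity))
    have := Real.pi_pos.ne'
    rw [pow_mul']
    field_simp
    norm_num
  · refine le_mul_of_one_le_right (by positivity) (hφone _ ?_)
    rw [norm_smul, Real.norm_of_nonneg hc.le]
    calc (2 : ℝ) ^ k * ‖w‖ ≤ 2 ^ k * (2 * 2 ^ k)⁻¹ := by gcongr
      _ = 1 / 2 := by field_simp
  · refine ⟨dist y x, hy, ?_⟩
    rw [Real.rpow_neg zero_le_two, Real.rpow_natCast, dist_comm x z]
    calc |dist z x - dist y x| ≤ dist z y := abs_dist_sub_le z y x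
      _ < (2 * 2 ^ k)⁻¹ := hz
      _ ≤ (2 ^ k)⁻¹ := by gcongr; linarith
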